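/- arXiv:1503.06242 — 5 statements merged into one kernel-verified Lean document; each statement's English description precedes it below -/
import Mathlib

section
/- Let S and Y be nonnegative real random variables that are independent, and let 0 < a ≤ b. Then P(S ≤ Y ≤ a) ≥ P(S ≤ Y) − P(a ≤ Y ≤ a + b) · P(S ≤ a + b) − P(Y ≥ a + b). (The lower bound on P^(1) = P(E_b + E_r ≤ E_d ≤ E_R^(m)) derived in Appendix A, which yields P_low^(1) of Eq. (8) with S = E_b + E_r, Y = E_d, a = E_R^(m), b = E_B^(m).) -/
open MeasureTheory ProbabilityTheory

theorem prob_low_one_bound {Ω : Type*} [MeasurableSpace Ω] (P : Measure Ω)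
    [IsProbabilityMeasure P]
    (S Y : Ω → ℝ) (hSm : Measurable S) (hYm : Measurable Y)
    (hS0 : ∀ ω, 0 ≤ S ω) (hY0 : ∀ ω, 0 ≤ Y ω)
    (hind : IndepFun S Y P) (a b : ℝ) (ha : 0 < a) (hab : a ≤ b) :
    (P {ω | S ω ≤ Y ω ∧ Y ω ≤ a}).toReal
      ≥ (P {ω | S ω ≤ Y ω}).toReal
        - (P {ω | a ≤ Y ω ∧ Y ω ≤ a + b}).toReal * (P {ω | S ω ≤ a + b}).toReal
        - (P {ω | a + b ≤ Y ω}).toReal := by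
  have hmul : P.real ({ω | a ≤ Y ω ∧ Y ω ≤ a + b} ∩ {ω | S ω ≤ a + b})
      = P.real {ω | a ≤ Y ω ∧ Y ω ≤ a + b} * P.real {ω | S ω ≤ a + b} := by
    have h := hind.symm.measure_inter_preimage_eq_mul (Set.Icc a (a + b)) (Set.Iic (a + b))
      measurableSet_Icc measurableSet_Iic
    exact (congrArg ENNReal.toReal h).trans ENNReal.toReal_mul
  have hsub : {ω | S ω ≤ Y ω} ⊆ ({ω | S ω ≤ Y ω ∧ Y ω ≤ a}
      ∪ ({ω | a ≤ Y ω ∧ Y ω ≤ a + b} ∩ {ω | S ω ≤ a + b})) ∪ {ω | a + b ≤ Y ω} := by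
    intro ω (hω : S ω ≤ Y ω)
    rcases le_total (Y ω) a with h1 | h1
    · exact Or.inl (Or.inl ⟨hω, h1⟩)
    rcases le_total (Y ω) (a + b) with h2 | h2
    · exact Or.inl (Or.inr ⟨⟨h1, h2⟩, hω.trans h2⟩)
    · exact Or.inr h2
  have hmono := (measureReal_mono (μ := P) hsub).trans (measureReal_union_le _ _)
  have hunion := measureReal_union_le (μ := P) {ω | S ω ≤ Y ω ∧ Y ω ≤ a}
    ({ω | a ≤ Y ω ∧ Y ω ≤ a + b} ∩ {ω | S ω ≤ a + b})
  simp only [← measureReal_def]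
  linarith
end

section
/- (Lemma 1 of the paper.) Let E_d, E_b, E_r be nonnegative real random variables such that E_d is independent of the pair (E_b, E_r), and let 0 < E_R ≤ E_B. Write S = E_b + E_r and C_ER = {E_b ≤ E_B} ∩ {E_d ≤ E_B} ∩ {E_r ≤ E_R} ∩ {S ≤ E_d}. Define P_low^(1) = max(0, P(S ≤ E_d) − P(E_R ≤ E_d ≤ E_B + E_R) · P(S ≤ E_B + E_R) − P(E_B + E_R ≤ E_d)) and P_low^(2) = P(E_R < E_d ≤ E_B) · P(S ≤ E_R). Then P_low^(1) + P_low^(2) ≤ P(C_ER). -/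
open MeasureTheory ProbabilityTheory

theorem lemma_one_P_low_le_P_ER {Ω : Type*} [MeasurableSpace Ω] (P : Measure Ω)
    [IsProbabilityMeasure P]
    (Ed Eb Er : Ω → ℝ) (hEdm : Measurable Ed) (hEbm : Measurable Eb) (hErm : Measurable Er)
    (hEd0 : ∀ ω, 0 ≤ Ed ω) (hEb0 : ∀ ω, 0 ≤ Eb ω) (hEr0 : ∀ ω, 0 ≤ Er ω)
    (hind : IndepFun Ed (fun ω => (Eb ω, Er ω)) P)
    (EB ER : ℝ) (hER : 0 < ER) (hERB : ER ≤ EB) :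
    max 0 ((P {ω | Eb ω + Er ω ≤ Ed ω}).toReal
          - (P {ω | ER ≤ Ed ω ∧ Ed ω ≤ EB + ER}).toReal
              * (P {ω | Eb ω + Er ω ≤ EB + ER}).toReal
          - (P {ω | EB + ER ≤ Ed ω}).toReal)
      + (P {ω | ER < Ed ω ∧ Ed ω ≤ EB}).toReal * (P {ω | Eb ω + Er ω ≤ ER}).toReal
    ≤ (P ({ω | Eb ω ≤ EB} ∩ {ω | Ed ω ≤ EB} ∩ {ω | Er ω ≤ ER}
          ∩ {ω | Eb ω + Er ω ≤ Ed ω})).toReal := by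
  have hS : Measurable fun p : ℝ × ℝ => p.1 + p.2 := by fun_prop
  have hmul (s t : Set ℝ) (hs : MeasurableSet s) (ht : MeasurableSet t) :
      P.real (Ed ⁻¹' s ∩ (fun ω => Eb ω + Er ω) ⁻¹' t)
        = P.real (Ed ⁻¹' s) * P.real ((fun ω => Eb ω + Er ω) ⁻¹' t) := by
    have h := hind.measure_inter_preimage_eq_mul s _ hs (hS ht)
    simpa [measureReal_def, Set.preimage_preimage] using congrArg ENNReal.toReal h
  have hlow := hmul (Set.Ioc ER EB) (Set.Iic ER) measurableSet_Ioc measurableSet_Iic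
  have hmid := hmul (Set.Icc ER (EB + ER)) (Set.Iic (EB + ER)) measurableSet_Icc measurableSet_Iic
  simp only [← measureReal_def]
  change max 0 (_ - P.real (Ed ⁻¹' Set.Icc ER (EB + ER))
      * P.real ((fun ω => Eb ω + Er ω) ⁻¹' Set.Iic (EB + ER)) - _)
    + P.real (Ed ⁻¹' Set.Ioc ER EB) * P.real ((fun ω => Eb ω + Er ω) ⁻¹' Set.Iic ER) ≤ _
  rw [← hlow, ← hmid]
  set C := {ω | Eb ω ≤ EB} ∩ {ω | Ed ω ≤ EB} ∩ {ω | Er ω ≤ ER} ∩ {ω | Eb ω + Er ω ≤ Ed ω} with hC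
  set A := Ed ⁻¹' Set.Icc ER (EB + ER) ∩ (fun ω => Eb ω + Er ω) ⁻¹' Set.Iic (EB + ER) with hA
  set B := Ed ⁻¹' Set.Ioc ER EB ∩ (fun ω => Eb ω + Er ω) ⁻¹' Set.Iic ER
  have hAm : MeasurableSet A :=
    (hEdm measurableSet_Icc).inter ((hEbm.add hErm) measurableSet_Iic)
  have hBCA : B ⊆ C ∩ A := by
    rintro ω ⟨⟨h1, h2⟩, h3⟩
    have hb := hEb0 ω
    have hr := hEr0 ω
    simp only [Set.mem_preimage, Set.mem_Iic] at h3
    simp only [hC, hA, Set.mem_inter_iff, Set.mem_ofPred_eq, Set.mem_preimage, Set.mem_Icc,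
      Set.mem_Iic]
    refine ⟨⟨⟨⟨?_, ?_⟩, ?_⟩, ?_⟩, ⟨?_, ?_⟩, ?_⟩ <;> linarith
  have hcover : {ω | Eb ω + Er ω ≤ Ed ω} ⊆ (C ∪ A) ∪ {ω | EB + ER ≤ Ed ω} := by
    intro ω h
    have hb := hEb0 ω
    have hr := hEr0 ω
    simp only [Set.mem_ofPred_eq] at h
    simp only [hC, hA, Set.mem_union, Set.mem_inter_iff, Set.mem_ofPred_eq, Set.mem_preimage,
      Set.mem_Icc, Set.mem_Iic]
    rcases lt_or_ge (Ed ω) ER with h1 | h1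
    · refine Or.inl (Or.inl ⟨⟨⟨?_, ?_⟩, ?_⟩, ?_⟩) <;> linarith
    · rcases le_total (EB + ER) (Ed ω) with h2 | h2
      · exact Or.inr h2
      · exact Or.inl (Or.inr ⟨⟨h1, h2⟩, h.trans h2⟩)
  have h1 : P.real B ≤ P.real (C ∩ A) := measureReal_mono hBCA
  have h2 : P.real (C ∩ A) ≤ P.real C := measureReal_mono Set.inter_subset_left
  have h3 := (measureReal_mono (μ := P) hcover).trans (measureReal_union_le _ _)
  have h4 := measureReal_union_add_inter (μ := P) (s := C) hAm
  rw [← le_sub_iff_add_le]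
  exact max_le (by linarith) (by linarith)
end

section
/- (Eq. (13) of the paper.) Under the hypotheses of Lemma 1, define the energy-efficient direct-transmission probability P_ED = P({E_d ≤ E_B} ∩ {E_b ≤ E_B} ∩ {E_r ≤ E_R}) − P(C_ER). Then P_ED ≤ P({E_d ≤ E_B} ∩ {E_b ≤ E_B} ∩ {E_r ≤ E_R}) − (P_low^(1) + P_low^(2)), where P_low^(1) = max(0, P(S ≤ E_d) − P(E_R ≤ E_d ≤ E_B + E_R)·P(S ≤ E_B + E_R) − P(E_B + E_R ≤ E_d)) and P_low^(2) = P(E_R < E_d ≤ E_B)·P(S ≤ E_R) with S = E_b + E_r. -/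
open MeasureTheory ProbabilityTheory

/-- If `X` is independent of the pair `(Y, Z)`, then events about `X` are independent of
threshold events about `Y + Z`. -/
lemma measureReal_inter_add_le_eq_mul {Ω : Type*} [MeasurableSpace Ω] {P : Measure Ω}
    {X Y Z : Ω → ℝ} (h : IndepFun X (fun ω => (Y ω, Z ω)) P)
    {s : Set ℝ} (hs : MeasurableSet s) (c : ℝ) :
    P.real (X ⁻¹' s ∩ {ω | Y ω + Z ω ≤ c}) = P.real (X ⁻¹' s) * P.real {ω | Y ω + Z ω ≤ c} := by
  have ht : MeasurableSet {p : ℝ × ℝ | p.1 + p.2 ≤ c} :=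
    measurableSet_le (by fun_prop) (by fun_prop)
  have key := h.measure_inter_preimage_eq_mul _ _ hs ht
  simp only [Measure.real, ← ENNReal.toReal_mul]
  exact congrArg ENNReal.toReal key

theorem upper_bound_P_ED {Ω : Type*} [MeasurableSpace Ω] (P : Measure Ω)
    [IsProbabilityMeasure P]
    (Ed Eb Er : Ω → ℝ) (hEdm : Measurable Ed) (hEbm : Measurable Eb) (hErm : Measurable Er)
    (hEd0 : ∀ ω, 0 ≤ Ed ω) (hEb0 : ∀ ω, 0 ≤ Eb ω) (hEr0 : ∀ ω, 0 ≤ Er ω)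
    (hind : IndepFun Ed (fun ω => (Eb ω, Er ω)) P)
    (EB ER : ℝ) (hER : 0 < ER) (hERB : ER ≤ EB) :
    (P ({ω | Ed ω ≤ EB} ∩ {ω | Eb ω ≤ EB} ∩ {ω | Er ω ≤ ER})).toReal
        - (P ({ω | Eb ω ≤ EB} ∩ {ω | Ed ω ≤ EB} ∩ {ω | Er ω ≤ ER}
            ∩ {ω | Eb ω + Er ω ≤ Ed ω})).toReal
      ≤ (P ({ω | Ed ω ≤ EB} ∩ {ω | Eb ω ≤ EB} ∩ {ω | Er ω ≤ ER})).toReal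
        - (max 0 ((P {ω | Eb ω + Er ω ≤ Ed ω}).toReal
              - (P {ω | ER ≤ Ed ω ∧ Ed ω ≤ EB + ER}).toReal
                  * (P {ω | Eb ω + Er ω ≤ EB + ER}).toReal
              - (P {ω | EB + ER ≤ Ed ω}).toReal)
            + (P {ω | ER < Ed ω ∧ Ed ω ≤ EB}).toReal
                * (P {ω | Eb ω + Er ω ≤ ER}).toReal) := by
  simp only [← measureReal_def]
  have hindep_wide : P.real {ω | ER ≤ Ed ω ∧ Ed ω ≤ EB + ER} * P.real {ω | Eb ω + Er ω ≤ EB + ER}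
      = P.real ({ω | ER ≤ Ed ω ∧ Ed ω ≤ EB + ER} ∩ {ω | Eb ω + Er ω ≤ EB + ER}) :=
    (measureReal_inter_add_le_eq_mul hind (measurableSet_Icc (a := ER) (b := EB + ER)) _).symm
  have hindep_mid : P.real {ω | ER < Ed ω ∧ Ed ω ≤ EB} * P.real {ω | Eb ω + Er ω ≤ ER}
      = P.real ({ω | ER < Ed ω ∧ Ed ω ≤ EB} ∩ {ω | Eb ω + Er ω ≤ ER}) :=
    (measureReal_inter_add_le_eq_mul hind (measurableSet_Ioc (a := ER) (b := EB)) _).symm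
  rw [hindep_wide, hindep_mid]
  set A : Set Ω := {ω | Eb ω + Er ω ≤ Ed ω ∧ Ed ω < ER}
  set B : Set Ω := {ω | ER < Ed ω ∧ Ed ω ≤ EB} ∩ {ω | Eb ω + Er ω ≤ ER}
  set D : Set Ω := {ω | ER ≤ Ed ω ∧ Ed ω ≤ EB + ER} ∩ {ω | Eb ω + Er ω ≤ EB + ER}
  have hB : MeasurableSet B :=
    ((measurableSet_lt measurable_const hEdm).inter (measurableSet_le hEdm measurable_const)).inter
      (measurableSet_le (hEbm.add hErm) measurable_const)
  have hAB : Disjoint A B := by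
    rw [Set.disjoint_left]
    rintro ω ⟨_, h⟩ ⟨⟨h', _⟩, _⟩
    exact lt_asymm h h'
  have hsub : A ∪ B ⊆ {ω | Eb ω ≤ EB} ∩ {ω | Ed ω ≤ EB} ∩ {ω | Er ω ≤ ER}
      ∩ {ω | Eb ω + Er ω ≤ Ed ω} := by
    rintro ω (⟨h₁, h₂⟩ | ⟨⟨h₁, h₂⟩, h₃ : Eb ω + Er ω ≤ ER⟩) <;>
      have := hEb0 ω <;> have := hEr0 ω <;>
      refine ⟨⟨⟨?_, ?_⟩, ?_⟩, ?_⟩ <;> simp only [Set.mem_ofPred_eq] <;> linarith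
  have hC := measureReal_mono (μ := P) hsub
  rw [measureReal_union hAB hB] at hC
  have hcover : {ω | Eb ω + Er ω ≤ Ed ω} ⊆ A ∪ D ∪ {ω | EB + ER ≤ Ed ω} := by
    intro ω (hω : Eb ω + Er ω ≤ Ed ω)
    rcases lt_or_ge (Ed ω) ER with h | h
    · exact Or.inl (Or.inl ⟨hω, h⟩)
    rcases le_total (Ed ω) (EB + ER) with h' | h'
    · exact Or.inl (Or.inr ⟨⟨h, h'⟩, hω.trans h'⟩)
    · exact Or.inr h'
  have hS := measureReal_mono (μ := P) hcover
  have hU := measureReal_union_le (μ := P) (A ∪ D) {ω | EB + ER ≤ Ed ω}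
  have hU' := measureReal_union_le (μ := P) A D
  have hmax : max 0 (P.real {ω | Eb ω + Er ω ≤ Ed ω} - P.real D - P.real {ω | EB + ER ≤ Ed ω})
      ≤ P.real A := max_le measureReal_nonneg (by linarith)
  linarith
end

section
/- Let E_d, E_b, E_r be nonnegative real random variables with E_b + E_r integrable, such that E_d is independent of the pair (E_b, E_r), and let 0 < E_R ≤ E_B. Write S = E_b + E_r and C_ER = {E_b ≤ E_B} ∩ {E_d ≤ E_B} ∩ {E_r ≤ E_R} ∩ {S ≤ E_d}. Then E[S · 1{C_ER}] ≥ E[S · 1{S ≤ E_d ≤ E_R}] + E[S · 1{S ≤ E_R}] · P(E_R < E_d ≤ E_B). (The decomposition lower bound on P_ER · E[E_b + E_r | C_ER] underlying Lemma 2, Appendix B.) -/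
open MeasureTheory ProbabilityTheory

/-- The integral of `f ∘ Y` over the intersection of an event of `Y` with an event of an
independent variable `X` factorizes. -/
theorem ProbabilityTheory.IndepFun.setIntegral_inter_preimage {Ω α β : Type*}
    [MeasurableSpace Ω] [MeasurableSpace α] [MeasurableSpace β] {P : Measure Ω}
    {X : Ω → α} {Y : Ω → β} (hXY : IndepFun X Y P) (hX : Measurable X) (hY : Measurable Y)
    {f : β → ℝ} (hf : Measurable f) {s : Set α} {t : Set β}
    (hs : MeasurableSet s) (ht : MeasurableSet t) :
    ∫ ω in Y ⁻¹' t ∩ X ⁻¹' s, f (Y ω) ∂P = (∫ ω in Y ⁻¹' t, f (Y ω) ∂P) * P.real (X ⁻¹' s) := by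
  have hg : Measurable (t.indicator f) := hf.indicator ht
  have hh : Measurable (s.indicator (1 : α → ℝ)) := measurable_one.indicator hs
  have hmul := (hXY.symm.comp hg hh).integral_fun_mul_eq_mul_integral
    (hg.comp hY).aestronglyMeasurable (hh.comp hX).aestronglyMeasurable
  have hX1 : s.indicator (1 : α → ℝ) ∘ X = (X ⁻¹' s).indicator 1 := rfl
  have hY1 : t.indicator f ∘ Y = (Y ⁻¹' t).indicator (fun ω => f (Y ω)) := rfl
  rw [hX1, hY1, integral_indicator_one (hX hs), integral_indicator (hY ht)] at hmul
  rw [← hmul, ← integral_indicator ((hY ht).inter (hX hs))]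
  congr 1 with ω
  by_cases h1 : ω ∈ Y ⁻¹' t <;> by_cases h2 : ω ∈ X ⁻¹' s <;> simp_all

theorem energy_ER_decomposition_bound {Ω : Type*} [MeasurableSpace Ω] (P : Measure Ω)
    [IsProbabilityMeasure P]
    (Ed Eb Er : Ω → ℝ) (hEdm : Measurable Ed) (hEbm : Measurable Eb) (hErm : Measurable Er)
    (hEd0 : ∀ ω, 0 ≤ Ed ω) (hEb0 : ∀ ω, 0 ≤ Eb ω) (hEr0 : ∀ ω, 0 ≤ Er ω)
    (hSint : Integrable (fun ω => Eb ω + Er ω) P)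
    (hind : IndepFun Ed (fun ω => (Eb ω, Er ω)) P)
    (EB ER : ℝ) (hER : 0 < ER) (hERB : ER ≤ EB) :
    ∫ ω in {ω | Eb ω ≤ EB} ∩ {ω | Ed ω ≤ EB} ∩ {ω | Er ω ≤ ER}
        ∩ {ω | Eb ω + Er ω ≤ Ed ω}, (Eb ω + Er ω) ∂P
      ≥ (∫ ω in {ω | Eb ω + Er ω ≤ Ed ω ∧ Ed ω ≤ ER}, (Eb ω + Er ω) ∂P)
        + (∫ ω in {ω | Eb ω + Er ω ≤ ER}, (Eb ω + Er ω) ∂P)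
            * (P {ω | ER < Ed ω ∧ Ed ω ≤ EB}).toReal := by
  have hSm : Measurable fun ω => Eb ω + Er ω := hEbm.add hErm
  have hsum : Measurable fun p : ℝ × ℝ => p.1 + p.2 := measurable_fst.add measurable_snd
  have hfactor : ∫ ω in {ω | Eb ω + Er ω ≤ ER} ∩ {ω | ER < Ed ω ∧ Ed ω ≤ EB}, (Eb ω + Er ω) ∂P
      = (∫ ω in {ω | Eb ω + Er ω ≤ ER}, (Eb ω + Er ω) ∂P)
        * (P {ω | ER < Ed ω ∧ Ed ω ≤ EB}).toReal :=
    hind.setIntegral_inter_preimage hEdm (hEbm.prodMk hErm) hsum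
      (measurableSet_Ioc : MeasurableSet (Set.Ioc ER EB))
      (measurableSet_le hsum measurable_const)
  have hmeas : MeasurableSet ({ω | Eb ω + Er ω ≤ ER} ∩ {ω | ER < Ed ω ∧ Ed ω ≤ EB}) :=
    (measurableSet_le hSm measurable_const).inter
      ((measurableSet_lt measurable_const hEdm).inter (measurableSet_le hEdm measurable_const))
  have hdisj : Disjoint {ω | Eb ω + Er ω ≤ Ed ω ∧ Ed ω ≤ ER}
      ({ω | Eb ω + Er ω ≤ ER} ∩ {ω | ER < Ed ω ∧ Ed ω ≤ EB}) :=
    Set.disjoint_left.2 fun _ h1 h2 => h1.2.not_gt h2.2.1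
  rw [ge_iff_le, ← hfactor,
    ← setIntegral_union hdisj hmeas hSint.integrableOn hSint.integrableOn]
  refine setIntegral_mono_set hSint.integrableOn
    (Filter.Eventually.of_forall fun ω => add_nonneg (hEb0 ω) (hEr0 ω))
    (LE.le.eventuallyLE ?_)
  rintro ω (⟨h1, h2⟩ | ⟨h1, h2, h3⟩)
  all_goals
    have hb := hEb0 ω
    have hr := hEr0 ω
    simp only [Set.mem_inter_iff, Set.mem_ofPred_eq] at h1 ⊢
    refine ⟨⟨⟨?_, ?_⟩, ?_⟩, ?_⟩ <;> linarith
end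

section
/- (Lemma 2 of the paper, exact version.) Let E_d, E_b, E_r be nonnegative real random variables such that E_d is independent of the pair (E_b, E_r), let 0 < E_R ≤ E_B, write S = E_b + E_r and C_ER = {E_b ≤ E_B} ∩ {E_d ≤ E_B} ∩ {E_r ≤ E_R} ∩ {S ≤ E_d}. Assume S is log-normal with parameters (μ, σ²), σ > 0, and let S′ be a log-normal random variable with parameters (μ + σ², σ²) independent of E_d. Then E[S · 1{C_ER}] ≥ exp(μ + σ²/2) · max(0, P(S′ ≤ E_d) − P(E_R ≤ E_d ≤ E_B + E_R) · P(S′ ≤ E_B + E_R) − P(E_B + E_R ≤ E_d)) + exp(μ + σ²/2) · Φ((ln E_R − μ)/σ − σ) · P(E_R < E_d ≤ E_B). (This is the bound E_low^(ER) = exp(μ_{b+r} + σ_{b+r}²/2)·P_low^(1,ER) + g(b+r, E_R^(m))·P_low^(2) ≤ P_ER · E[E_{b+r} | C_ER], with P_low^(1,ER) computed with the scaled distribution exp(σ²)·S.) -/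
open MeasureTheory ProbabilityTheory

/-- The standard normal CDF `Φ`. -/
noncomputable def stdNormalCDF (x : ℝ) : ℝ :=
  ∫ u in Set.Iic x, (Real.sqrt (2 * Real.pi))⁻¹ * Real.exp (-u ^ 2 / 2)

/-- `X` is log-normal with parameters `(μ, σ²)`: its law is the pushforward of the
standard Gaussian measure under `t ↦ exp (μ + σ t)`. -/
def IsLogNormal {Ω : Type*} [MeasurableSpace Ω] (P : Measure Ω) (X : Ω → ℝ) (μ σ : ℝ) : Prop :=
  Measure.map X P = Measure.map (fun t => Real.exp (μ + σ * t)) (gaussianReal 0 1)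

/-- Exponential tilting of the standard Gaussian. -/
lemma gaussianReal_withDensity_exp (μ σ : ℝ) :
    (gaussianReal 0 1).withDensity (fun t => ENNReal.ofReal (Real.exp (μ + σ * t)))
      = ENNReal.ofReal (Real.exp (μ + σ ^ 2 / 2)) • gaussianReal σ 1 := by
  rw [gaussianReal_of_var_ne_zero _ one_ne_zero, gaussianReal_of_var_ne_zero _ one_ne_zero,
    ← withDensity_mul _ (measurable_gaussianPDF _ _) (by fun_prop),
    ← withDensity_smul _ (measurable_gaussianPDF _ _)]
  congr 1
  ext t
  simp only [Pi.mul_apply, Pi.smul_apply, smul_eq_mul, gaussianPDF, gaussianPDFReal]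
  rw [← ENNReal.ofReal_mul (by positivity), ← ENNReal.ofReal_mul (by positivity), mul_assoc,
    ← Real.exp_add, mul_left_comm, ← Real.exp_add]
  congr 3
  push_cast
  ring

/-- Size-biasing a log-normal law with parameters `(μ, σ²)` gives, up to its mean, the log-normal
law with parameters `(μ + σ², σ²)`. -/
lemma IsLogNormal.withDensity_map {Ω : Type*} [MeasurableSpace Ω] {P : Measure Ω} {X Y : Ω → ℝ}
    {μ σ : ℝ} (hX : IsLogNormal P X μ σ) (hY : IsLogNormal P Y (μ + σ ^ 2) σ) :
    (P.map X).withDensity ENNReal.ofReal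
      = ENNReal.ofReal (Real.exp (μ + σ ^ 2 / 2)) • P.map Y := by
  have hshift : (gaussianReal 0 1).map (fun t => Real.exp (μ + σ ^ 2 + σ * t))
      = (gaussianReal σ 1).map (fun t => Real.exp (μ + σ * t)) := by
    have h := gaussianReal_map_add_const (μ := 0) (v := 1) σ
    rw [zero_add] at h
    rw [← h, Measure.map_map (by fun_prop) (by fun_prop)]
    congr 1
    ext t
    simp only [Function.comp_apply]
    ring_nf
  rw [IsLogNormal] at hX hY
  rw [hX, hY, hshift, ← Measure.map_smul, ← gaussianReal_withDensity_exp]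
  ext s hs
  have hm : Measurable fun t : ℝ => Real.exp (μ + σ * t) := by fun_prop
  rw [withDensity_apply _ hs, Measure.map_apply hm hs, withDensity_apply _ (hm hs),
    setLIntegral_map hs ENNReal.measurable_ofReal hm]

/-- The size-biasing identity, jointly with an independent random variable. -/
lemma IsLogNormal.setLIntegral_eq {Ω : Type*} [MeasurableSpace Ω] {P : Measure Ω}
    [IsProbabilityMeasure P] {X Y Z : Ω → ℝ} {μ σ : ℝ}
    (hX : IsLogNormal P X μ σ) (hY : IsLogNormal P Y (μ + σ ^ 2) σ)
    (hXm : Measurable X) (hYm : Measurable Y) (hZm : Measurable Z)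
    (hXZ : IndepFun X Z P) (hYZ : IndepFun Y Z P) {A : Set (ℝ × ℝ)} (hA : MeasurableSet A) :
    ∫⁻ ω in {ω | (X ω, Z ω) ∈ A}, ENNReal.ofReal (X ω) ∂P
      = ENNReal.ofReal (Real.exp (μ + σ ^ 2 / 2)) * P {ω | (Y ω, Z ω) ∈ A} := by
  have hXmap := (indepFun_iff_map_prod_eq_prod_map_map hXm.aemeasurable hZm.aemeasurable).1 hXZ
  have hYmap := (indepFun_iff_map_prod_eq_prod_map_map hYm.aemeasurable hZm.aemeasurable).1 hYZ
  have : IsProbabilityMeasure (P.map Z) := Measure.isProbabilityMeasure_map hZm.aemeasurable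
  have : IsProbabilityMeasure (P.map X) := Measure.isProbabilityMeasure_map hXm.aemeasurable
  have h1 := prod_withDensity_left (μ := P.map X) (ν := P.map Z) ENNReal.measurable_ofReal
  rw [hX.withDensity_map hY, Measure.prod_smul_left, ← hXmap, ← hYmap] at h1
  have h2 := congrArg (fun m => m A) h1
  simp only [Measure.smul_apply, smul_eq_mul] at h2
  rw [withDensity_apply _ hA, Measure.map_apply (by fun_prop) hA,
    setLIntegral_map hA (by fun_prop) (by fun_prop)] at h2
  exact h2.symm

lemma gaussianReal_Iic_toReal (x : ℝ) :
    (gaussianReal 0 1 (Set.Iic x)).toReal = stdNormalCDF x := by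
  rw [gaussianReal_apply_eq_integral _ one_ne_zero, ENNReal.toReal_ofReal]
  · simp [stdNormalCDF, gaussianPDFReal]
  · exact integral_nonneg fun _ => gaussianPDFReal_nonneg _ _ _

lemma IsLogNormal.measure_le_toReal {Ω : Type*} [MeasurableSpace Ω] {P : Measure Ω} {X : Ω → ℝ}
    {μ σ : ℝ} (hX : IsLogNormal P X μ σ) (hXm : Measurable X) (hσ : 0 < σ) {x : ℝ} (hx : 0 < x) :
    (P {ω | X ω ≤ x}).toReal = stdNormalCDF ((Real.log x - μ) / σ) := by
  have h := congrArg (fun m => m (Set.Iic x)) hX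
  rw [Measure.map_apply hXm measurableSet_Iic,
    Measure.map_apply (by fun_prop) measurableSet_Iic] at h
  rw [← gaussianReal_Iic_toReal]
  refine congrArg ENNReal.toReal (h.trans (congrArg _ ?_))
  ext t
  simp only [Set.mem_preimage, Set.mem_Iic]
  rw [← Real.le_log_iff_exp_le hx, le_div_iff₀ hσ]
  constructor <;> intro h <;> linarith

theorem lemma_two_E_low_ER {Ω : Type*} [MeasurableSpace Ω] (P : Measure Ω)
    [IsProbabilityMeasure P]
    (Ed Eb Er S' : Ω → ℝ)
    (hEdm : Measurable Ed) (hEbm : Measurable Eb) (hErm : Measurable Er) (hS'm : Measurable S')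
    (hEd0 : ∀ ω, 0 ≤ Ed ω) (hEb0 : ∀ ω, 0 ≤ Eb ω) (hEr0 : ∀ ω, 0 ≤ Er ω)
    (hind : IndepFun Ed (fun ω => (Eb ω, Er ω)) P)
    (EB ER : ℝ) (hER : 0 < ER) (hERB : ER ≤ EB)
    (μ σ : ℝ) (hσ : 0 < σ)
    (hS : IsLogNormal P (fun ω => Eb ω + Er ω) μ σ)
    (hS' : IsLogNormal P S' (μ + σ ^ 2) σ)
    (hindS' : IndepFun S' Ed P) :
    ∫ ω in {ω | Eb ω ≤ EB} ∩ {ω | Ed ω ≤ EB} ∩ {ω | Er ω ≤ ER}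
        ∩ {ω | Eb ω + Er ω ≤ Ed ω}, (Eb ω + Er ω) ∂P
      ≥ Real.exp (μ + σ ^ 2 / 2)
            * max 0 ((P {ω | S' ω ≤ Ed ω}).toReal
                - (P {ω | ER ≤ Ed ω ∧ Ed ω ≤ EB + ER}).toReal
                    * (P {ω | S' ω ≤ EB + ER}).toReal
                - (P {ω | EB + ER ≤ Ed ω}).toReal)
        + Real.exp (μ + σ ^ 2 / 2) * stdNormalCDF ((Real.log ER - μ) / σ - σ)
            * (P {ω | ER < Ed ω ∧ Ed ω ≤ EB}).toReal := by
  have hSm : Measurable fun ω => Eb ω + Er ω := by fun_prop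
  have hindS : IndepFun (fun ω => Eb ω + Er ω) Ed P :=
    (hind.comp measurable_id (measurable_fst.add measurable_snd)).symm
  set c := Real.exp (μ + σ ^ 2 / 2)
  have hc0 : 0 < c := Real.exp_pos _
  let A : Set (ℝ × ℝ) := {p | p.1 ≤ p.2 ∧ p.2 < ER}
  let B : Set (ℝ × ℝ) := {p | p.1 ≤ ER ∧ ER < p.2 ∧ p.2 ≤ EB}
  have hA : MeasurableSet A :=
    (measurableSet_le measurable_fst measurable_snd).inter
      (measurableSet_lt measurable_snd measurable_const)
  have hB : MeasurableSet B :=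
    (measurableSet_le measurable_fst measurable_const).inter
      ((measurableSet_lt measurable_const measurable_snd).inter
        (measurableSet_le measurable_snd measurable_const))
  have hindep (s t : Set ℝ) (hs : MeasurableSet s) (ht : MeasurableSet t) :
      P.real {ω | S' ω ∈ s ∧ Ed ω ∈ t} = P.real {ω | S' ω ∈ s} * P.real {ω | Ed ω ∈ t} := by
    have h := hindS'.measure_inter_preimage_eq_mul s t hs ht
    rw [measureReal_def, measureReal_def, measureReal_def, ← ENNReal.toReal_mul]
    exact congrArg ENNReal.toReal h
  have hlow : ∫ ω in {ω | (Eb ω + Er ω, Ed ω) ∈ A ∪ B}, (Eb ω + Er ω) ∂P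
      = c * (P.real {ω | (S' ω, Ed ω) ∈ A} + P.real {ω | (S' ω, Ed ω) ∈ B}) := by
    rw [integral_eq_lintegral_of_nonneg_ae
        (Filter.Eventually.of_forall fun ω => add_nonneg (hEb0 ω) (hEr0 ω))
        hSm.aestronglyMeasurable,
      hS.setLIntegral_eq hS' hSm hS'm hEdm hindS hindS' (hA.union hB),
      ENNReal.toReal_mul, ENNReal.toReal_ofReal hc0.le, ← measureReal_def]
    congr 1
    refine measureReal_union (Set.disjoint_left.2 ?_)
      ((hS'm.prodMk hEdm) hB)
    rintro ω ⟨-, h1⟩ ⟨-, h2, -⟩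
    exact lt_asymm h1 h2
  have hBprob : P.real {ω | (S' ω, Ed ω) ∈ B}
      = stdNormalCDF ((Real.log ER - μ) / σ - σ) * P.real {ω | ER < Ed ω ∧ Ed ω ≤ EB} := by
    refine (hindep (Set.Iic ER) (Set.Ioc ER EB) measurableSet_Iic measurableSet_Ioc).trans ?_
    congr 1
    refine (hS'.measure_le_toReal hS'm hσ hER).trans (congrArg _ ?_)
    field_simp
    ring
  have hAprob : P.real {ω | S' ω ≤ Ed ω}
      ≤ P.real {ω | (S' ω, Ed ω) ∈ A}
        + P.real {ω | ER ≤ Ed ω ∧ Ed ω ≤ EB + ER} * P.real {ω | S' ω ≤ EB + ER}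
        + P.real {ω | EB + ER ≤ Ed ω} := by
    have h := hindep (Set.Iic (EB + ER)) (Set.Icc ER (EB + ER)) measurableSet_Iic measurableSet_Icc
    simp only [Set.mem_Iic, Set.mem_Icc] at h
    rw [mul_comm, ← h]
    refine (measureReal_mono ?_).trans ((measureReal_union_le (_ ∪ _) _).trans
      (add_le_add_left (measureReal_union_le _ _) _))
    intro ω (hω : S' ω ≤ Ed ω)
    rcases lt_or_ge (Ed ω) ER with h1 | h1
    · exact Or.inl (Or.inl ⟨hω, h1⟩)
    · rcases le_total (Ed ω) (EB + ER) with h2 | h2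
      · exact Or.inl (Or.inr ⟨hω.trans h2, h1, h2⟩)
      · exact Or.inr h2
  have hmono : ∫ ω in {ω | (Eb ω + Er ω, Ed ω) ∈ A ∪ B}, (Eb ω + Er ω) ∂P
      ≤ ∫ ω in {ω | Eb ω ≤ EB} ∩ {ω | Ed ω ≤ EB} ∩ {ω | Er ω ≤ ER}
        ∩ {ω | Eb ω + Er ω ≤ Ed ω}, (Eb ω + Er ω) ∂P := by
    have hC : MeasurableSet ({ω | Eb ω ≤ EB} ∩ {ω | Ed ω ≤ EB} ∩ {ω | Er ω ≤ ER}
        ∩ {ω | Eb ω + Er ω ≤ Ed ω}) :=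
      (((measurableSet_le hEbm measurable_const).inter
        (measurableSet_le hEdm measurable_const)).inter
        (measurableSet_le hErm measurable_const)).inter (measurableSet_le hSm hEdm)
    refine setIntegral_mono_set ?_
      (Filter.Eventually.of_forall fun ω => add_nonneg (hEb0 ω) (hEr0 ω))
      (LE.le.eventuallyLE ?_)
    · refine Measure.integrableOn_of_bounded (M := EB) (measure_ne_top _ _)
        hSm.aestronglyMeasurable ?_
      filter_upwards [ae_restrict_mem hC] with ω hω
      rw [Real.norm_of_nonneg (add_nonneg (hEb0 ω) (hEr0 ω))]
      exact hω.2.trans hω.1.1.2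
    · intro ω hω
      have hb := hEb0 ω
      have hr := hEr0 ω
      simp only [Set.mem_inter_iff, Set.mem_ofPred_eq]
      rcases hω with ⟨h1, h2⟩ | ⟨h1, h2, h3⟩ <;> simp only at h1 h2 <;>
        refine ⟨⟨⟨?_, ?_⟩, ?_⟩, ?_⟩ <;> linarith
  refine le_trans ?_ (hlow.symm.le.trans hmono)
  simp only [← measureReal_def]
  rw [mul_assoc, ← mul_add, ← hBprob]
  gcongr
  exact max_le measureReal_nonneg (by linarith)
end
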